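/- Let H be a real Hilbert space, let A : H → Set H be maximally monotone, let μ > 0, let γ ∈ (0, 1/μ), and set β = 1 − γμ. Then for every x ∈ H there exists a unique q ∈ H such that x − q ∈ {γ(u − μq) : u ∈ A q} (equivalently, β⁻¹x − q ∈ {β⁻¹γ u : u ∈ A q}), so the operator J : H → H sending x to this q is well defined with domain all of H; moreover J is β-cocoercive, i.e., for all x, y ∈ H, ⟪x − y, Jx − Jy⟫ ≥ β‖Jx − Jy‖². -/

import Mathlib

open RealInnerProductSpace

section

open Filter Topology

variable {H : Type*} [NormedAddCommGroup H] [InnerProductSpace ℝ H]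

/-- Minimizing `‖c‖ ^ 2 + p` over a convex set of pairs `(c, p)` yields a limit point `x` at which
the first-order optimality condition holds. -/
lemma exists_norm_sq_le_two_inner_add [CompleteSpace H] {C : Set (H × ℝ)} (hC : Convex ℝ C)
    (hne : C.Nonempty) (hnonneg : ∀ k ∈ C, 0 ≤ ‖k.1‖ ^ 2 + k.2) :
    ∃ x : H, ∀ k ∈ C, ‖x‖ ^ 2 ≤ 2 * ⟪x, k.1⟫ + k.2 := by
  let h : H × ℝ → ℝ := fun k ↦ ‖k.1‖ ^ 2 + k.2
  have hbdd : BddBelow (h '' C) := ⟨0, by rintro _ ⟨k, hk, rfl⟩; exact hnonneg k hk⟩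
  set m := sInf (h '' C)
  have hm_le : ∀ k ∈ C, m ≤ h k := fun k hk ↦ csInf_le hbdd ⟨k, hk, rfl⟩
  have hm_nonneg : 0 ≤ m := by
    refine le_csInf (hne.image h) ?_
    rintro _ ⟨k, hk, rfl⟩
    exact hnonneg k hk
  have hex : ∀ n : ℕ, ∃ k ∈ C, h k < m + 1 / ((n : ℝ) + 1) := by
    intro n
    obtain ⟨_, ⟨k, hk, rfl⟩, hlt⟩ := exists_lt_of_csInf_lt (hne.image h)
      (show sInf (h '' C) < m + 1 / ((n : ℝ) + 1) from lt_add_of_pos_right _ (by positivity))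
    exact ⟨k, hk, hlt⟩
  choose k hkC hk using hex
  have hstep : ∀ a ∈ C, ∀ b ∈ C, ∀ t : ℝ, 0 ≤ t → t ≤ 1 →
      m ≤ h a + t * (2 * ⟪a.1, b.1⟫ - ‖a.1‖ ^ 2 + b.2 - h a) + t ^ 2 * ‖b.1 - a.1‖ ^ 2 := by
    intro a ha b hb t ht0 ht1
    have := hm_le _ (hC ha hb (sub_nonneg.2 ht1) ht0 (by ring))
    simp only [h, Prod.fst_add, Prod.snd_add, Prod.smul_fst, Prod.smul_snd, smul_eq_mul] at this ⊢
    rw [norm_add_sq_real, norm_smul, norm_smul, mul_pow, mul_pow, Real.norm_eq_abs,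
      Real.norm_eq_abs, sq_abs, sq_abs, real_inner_smul_left, real_inner_smul_right] at this
    rw [norm_sub_sq_real, real_inner_comm a.1 b.1]
    linarith
  have hdist : ∀ i j, ‖(k i).1 - (k j).1‖ ^ 2 ≤ 2 * (1 / ((i : ℝ) + 1) + 1 / ((j : ℝ) + 1)) := by
    intro i j
    have h1 := hstep _ (hkC i) _ (hkC j) (1 / 2) (by norm_num) (by norm_num)
    have h2 := hk i
    have h3 := hk j
    have h4 := norm_sub_sq_real (k i).1 (k j).1
    rw [norm_sub_rev (k j).1] at h1
    simp only [h] at h1 h2 h3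
    linarith
  have hlim0 : Tendsto (fun n : ℕ ↦ 1 / ((n : ℝ) + 1)) atTop (𝓝 0) :=
    tendsto_one_div_add_atTop_nhds_zero_nat
  have hcauchy : CauchySeq fun n ↦ (k n).1 := by
    rw [Metric.cauchySeq_iff']
    intro ε hε
    obtain ⟨N, hN⟩ := (hlim0.eventually_lt_const (show 0 < ε ^ 2 / 4 by positivity)).exists
    refine ⟨N, fun n hn ↦ ?_⟩
    have hle : 1 / ((n : ℝ) + 1) ≤ 1 / ((N : ℝ) + 1) := by gcongr
    rw [dist_eq_norm]
    exact lt_of_pow_lt_pow_left₀ 2 hε.le (by linarith [hdist n N])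
  obtain ⟨x, hx⟩ := cauchySeq_tendsto_of_complete hcauchy
  have hhm : Tendsto (fun n ↦ h (k n)) atTop (𝓝 m) :=
    tendsto_of_tendsto_of_tendsto_of_le_of_le tendsto_const_nhds
      (by simpa using hlim0.const_add m) (fun n ↦ hm_le _ (hkC n)) (fun n ↦ (hk n).le)
  refine ⟨x, fun e he ↦ ?_⟩
  have hlimit : ∀ t : ℝ, 0 < t → t ≤ 1 →
      m ≤ m + t * (2 * ⟪x, e.1⟫ - ‖x‖ ^ 2 + e.2 - m) + t ^ 2 * ‖e.1 - x‖ ^ 2 := by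
    intro t ht0 ht1
    refine ge_of_tendsto' (x := atTop) ?_ fun n ↦ hstep _ (hkC n) e he t ht0.le ht1
    have hinner : Tendsto (fun n ↦ ⟪(k n).1, e.1⟫) atTop (𝓝 ⟪x, e.1⟫) :=
      hx.inner tendsto_const_nhds
    exact (hhm.add ((((((hinner.const_mul 2).sub (hx.norm.pow 2)).add_const _).sub
      hhm)).const_mul t)).add (((hx.const_sub e.1).norm.pow 2).const_mul (t ^ 2))
  have hopt : 0 ≤ 2 * ⟪x, e.1⟫ - ‖x‖ ^ 2 + e.2 - m := by
    have hT : Tendsto (fun n : ℕ ↦ 2 * ⟪x, e.1⟫ - ‖x‖ ^ 2 + e.2 - m +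
        1 / ((n : ℝ) + 1) * ‖e.1 - x‖ ^ 2) atTop (𝓝 (2 * ⟪x, e.1⟫ - ‖x‖ ^ 2 + e.2 - m)) := by
      simpa using (hlim0.mul_const (‖e.1 - x‖ ^ 2)).const_add (2 * ⟪x, e.1⟫ - ‖x‖ ^ 2 + e.2 - m)
    refine ge_of_tendsto' hT fun n ↦ ?_
    have ht : 0 < 1 / ((n : ℝ) + 1) := by positivity
    have ht1 : 1 / ((n : ℝ) + 1) ≤ 1 := by
      rw [div_le_one (by positivity)]
      linarith [(Nat.cast_nonneg n : (0 : ℝ) ≤ n)]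
    have := hlimit _ ht ht1
    refine nonneg_of_mul_nonneg_right ?_ ht
    linarith
  linarith

/-- On the convex hull of the points `(y, v, ⟪y, v⟫)` with `(y, v)` in a monotone set, the last
coordinate dominates the inner product of the first two. -/
lemma inner_le_of_mem_convexHull_of_monotone {G : Set (H × H)}
    (hG : ∀ a ∈ G, ∀ b ∈ G, 0 ≤ ⟪a.1 - b.1, a.2 - b.2⟫) {w : H × H × ℝ}
    (hw : w ∈ convexHull ℝ ((fun a : H × H ↦ (a.1, a.2, ⟪a.1, a.2⟫)) '' G)) :
    ⟪w.1, w.2.1⟫ ≤ w.2.2 := by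
  have hconv : ∀ (a b : H) (p : ℝ),
      Convex ℝ {w : H × H × ℝ | ⟪a, w.2.1⟫ + ⟪b, w.1⟫ ≤ p + w.2.2} := by
    intro a b p w₁ hw₁ w₂ hw₂ s t hs ht hst
    simp only [Set.mem_ofPred_eq, Prod.fst_add, Prod.snd_add, Prod.smul_fst, Prod.smul_snd,
      smul_eq_mul, inner_add_right, real_inner_smul_right] at *
    have h1 := mul_le_mul_of_nonneg_left hw₁ hs
    have h2 := mul_le_mul_of_nonneg_left hw₂ ht
    have h3 : p = s * p + t * p := by rw [← add_mul, hst, one_mul]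
    linarith
  have hpoint : ∀ a ∈ G, ⟪a.1, w.2.1⟫ + ⟪a.2, w.1⟫ ≤ ⟪a.1, a.2⟫ + w.2.2 := by
    intro a ha
    refine convexHull_min ?_ (hconv a.1 a.2 ⟪a.1, a.2⟫) hw
    rintro _ ⟨b, hb, rfl⟩
    have := hG a ha b hb
    simp only [inner_sub_left, inner_sub_right] at this
    simp only [Set.mem_ofPred_eq, real_inner_comm b.1 a.2]
    linarith
  have hself : ⟪w.1, w.2.1⟫ + ⟪w.2.1, w.1⟫ ≤ w.2.2 + w.2.2 := by
    refine convexHull_min ?_ (hconv w.1 w.2.1 w.2.2) hw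
    rintro _ ⟨b, hb, rfl⟩
    have := hpoint b hb
    simp only [Set.mem_ofPred_eq]
    rw [real_inner_comm b.2 w.1, real_inner_comm b.1 w.2.1]
    linarith
  rw [real_inner_comm w.1] at hself
  linarith

/-- **Minty's theorem**, in extension form: for a monotone set `G` and every `z`, some pair
`(x, z - x)` is monotonically related to all of `G`. -/
lemma exists_forall_inner_sub_nonneg_of_monotone [CompleteSpace H] {G : Set (H × H)}
    (hG : ∀ a ∈ G, ∀ b ∈ G, 0 ≤ ⟪a.1 - b.1, a.2 - b.2⟫) (z : H) :
    ∃ x : H, ∀ a ∈ G, 0 ≤ ⟪x - a.1, z - x - a.2⟫ := by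
  obtain rfl | hne := G.eq_empty_or_nonempty
  · exact ⟨0, by simp⟩
  let G' : Set (H × H) := (fun a ↦ (a.1, a.2 - z)) '' G
  have hG' : ∀ a ∈ G', ∀ b ∈ G', 0 ≤ ⟪a.1 - b.1, a.2 - b.2⟫ := by
    rintro _ ⟨a, ha, rfl⟩ _ ⟨b, hb, rfl⟩
    simpa using hG a ha b hb
  let K := convexHull ℝ ((fun a : H × H ↦ (a.1, a.2, ⟪a.1, a.2⟫)) '' G')
  let L : H × H × ℝ →ₗ[ℝ] H × ℝ :=
    ((1 / 2 : ℝ) • (LinearMap.fst ℝ H (H × ℝ) -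
      LinearMap.fst ℝ H ℝ ∘ₗ LinearMap.snd ℝ H (H × ℝ))).prod
      (LinearMap.snd ℝ H ℝ ∘ₗ LinearMap.snd ℝ H (H × ℝ))
  have hL : ∀ w, L w = ((1 / 2 : ℝ) • (w.1 - w.2.1), w.2.2) := fun _ ↦ rfl
  obtain ⟨x, hx⟩ := exists_norm_sq_le_two_inner_add (C := L '' K)
    ((convex_convexHull ℝ _).linear_image L)
    ((((hne.image _).image _).convexHull).image L) (by
      rintro _ ⟨w, hw, rfl⟩
      have h1 := inner_le_of_mem_convexHull_of_monotone hG' hw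
      have h2 := norm_sub_sq_real w.1 w.2.1
      have h3 := norm_add_sq_real w.1 w.2.1
      have h4 := sq_nonneg ‖w.1 + w.2.1‖
      rw [hL, norm_smul, mul_pow, Real.norm_eq_abs, sq_abs]
      dsimp only
      linarith)
  refine ⟨x, fun a ha ↦ ?_⟩
  have := hx _ ⟨_, subset_convexHull ℝ _ ⟨_, ⟨a, ha, rfl⟩, rfl⟩, rfl⟩
  rw [hL] at this
  simp only [real_inner_smul_right, inner_sub_right] at this
  simp only [inner_sub_left, inner_sub_right, real_inner_self_eq_norm_sq]
  rw [real_inner_comm x a.1] at *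
  linarith

end

/-- For a maximally monotone operator `A` on a real Hilbert space, `μ > 0` and
`γ ∈ (0, 1/μ)`, setting `β = 1 - γμ` and `B = A - μ Id`, the resolvent
`J = J_{γB}` is a well-defined single-valued operator on all of `H`
(i.e. for every `x` there is a unique `q` with `x - q ∈ γ(A q - μ q)`),
and `J` is `β`-cocoercive. -/
theorem resolvent_of_shifted_maxMonotone_cocoercive
    {H : Type*} [NormedAddCommGroup H] [InnerProductSpace ℝ H] [CompleteSpace H]
    (A : H → Set H)
    (hmono : ∀ x y u v : H, u ∈ A x → v ∈ A y → ⟪x - y, u - v⟫ ≥ 0)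
    (hmax : ∀ x u : H, (∀ y v : H, v ∈ A y → ⟪x - y, u - v⟫ ≥ 0) → u ∈ A x)
    (μ γ : ℝ) (hμ : 0 < μ) (hγ : γ ∈ Set.Ioo 0 (1 / μ))
    (β : ℝ) (hβ : β = 1 - γ * μ) :
    (∀ x : H, ∃! q : H, ∃ u ∈ A q, x - q = γ • (u - μ • q)) ∧
    (∀ J : H → H, (∀ x : H, ∃ u ∈ A (J x), x - J x = γ • (u - μ • J x)) →
      ∀ x y : H, ⟪x - y, J x - J y⟫ ≥ β * ‖J x - J y‖ ^ 2) := by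
  obtain ⟨hγ0, hγ1⟩ := hγ
  have hβ0 : 0 < β := by
    rw [lt_div_iff₀ hμ] at hγ1
    linarith
  have hcoco : ∀ x y p q u v : H, u ∈ A p → v ∈ A q → x - p = γ • (u - μ • p) →
      y - q = γ • (v - μ • q) → β * ‖p - q‖ ^ 2 ≤ ⟪x - y, p - q⟫ := by
    intro x y p q u v hu hv hx hy
    have hxy : x - y = β • (p - q) + γ • (u - v) := by
      rw [sub_eq_iff_eq_add.1 hx, sub_eq_iff_eq_add.1 hy, hβ]
      module
    rw [hxy, inner_add_left, real_inner_smul_left, real_inner_smul_left,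
      real_inner_self_eq_norm_sq, real_inner_comm]
    linarith [mul_nonneg hγ0.le (hmono p q u v hu hv)]
  refine ⟨fun x ↦ ?_, fun J hJ x y ↦ ?_⟩
  · have hs : 0 < γ / β := div_pos hγ0 hβ0
    obtain ⟨q, hq⟩ := exists_forall_inner_sub_nonneg_of_monotone
      (G := {a : H × H | ∃ u ∈ A a.1, a.2 = (γ / β) • u}) (by
        rintro ⟨a, _⟩ ⟨u, hu, rfl⟩ ⟨b, _⟩ ⟨v, hv, rfl⟩
        rw [← smul_sub, real_inner_smul_right]
        exact mul_nonneg hs.le (hmono a b u v hu hv)) (β⁻¹ • x)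
    have hsol : ∃ u ∈ A q, x - q = γ • (u - μ • q) := by
      refine ⟨(γ / β)⁻¹ • (β⁻¹ • x - q), hmax _ _ fun y v hv ↦ ?_, ?_⟩
      · have hyv := hq (y, (γ / β) • v) ⟨v, hv, rfl⟩
        have hsplit : β⁻¹ • x - q - (γ / β) • v =
            (γ / β) • ((γ / β)⁻¹ • (β⁻¹ • x - q) - v) := by
          rw [smul_sub, smul_inv_smul₀ hs.ne']
        dsimp only at hyv
        rw [hsplit, real_inner_smul_right] at hyv
        exact nonneg_of_mul_nonneg_right hyv hs
      · have hcoef : γ * (γ / β)⁻¹ = β := by field_simp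
        rw [smul_sub, smul_smul, hcoef, smul_sub, smul_inv_smul₀ hβ0.ne', hβ]
        module
    refine ⟨q, hsol, ?_⟩
    rintro p ⟨u, hu, hp⟩
    obtain ⟨v, hv, hq'⟩ := hsol
    have hle := hcoco x x p q u v hu hv hp hq'
    rw [sub_self, inner_zero_left] at hle
    have hsq : ‖p - q‖ ^ 2 = 0 := le_antisymm (nonpos_of_mul_nonpos_right hle hβ0) (sq_nonneg _)
    exact sub_eq_zero.1 (norm_eq_zero.1 (pow_eq_zero_iff two_ne_zero |>.1 hsq))
  · obtain ⟨u, hu, hx⟩ := hJ x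
    obtain ⟨v, hv, hy⟩ := hJ y
    exact hcoco x y _ _ u v hu hv hx hy
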